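/- Let X be a compact metrizable space, let 𝒜 = {A₁,…,A_m} and ℬ = {B₁,…,B_m} be partitions of X, and let ℱ = {f₁,…,f_m} and 𝒢 = {g₁,…,g_m} be Markov maps on (X,𝒜) and (X,ℬ) respectively. If ℱ and 𝒢 are both topologically expanding and are combinatorially conjugate, then they are topologically conjugate; that is, there exists a homeomorphism H : X → X such that H(f_i(x)) = g_i(H(x)) for every i ∈ {1,…,m} and every x ∈ A_i. -/

import Mathlib

noncomputable section

open Set Topology Filter

/-- The set of break-points of an indexed family `A` of subsets of `X`: points that belong
to two distinct members of the family. -/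
def bkSet {X : Type*} {m : ℕ} (A : Fin m → Set X) : Set X :=
  {x | ∃ i j : Fin m, i ≠ j ∧ x ∈ A i ∧ x ∈ A j}

/-- A Markov map `ℱ = {f₁, …, f_m}` on a partition `𝒜 = {A₁, …, A_m}` of a topological
space `X`: the pieces are closed, connected, have pairwise finite intersections and cover `X`;
each `f i` restricted to `A i` is a homeomorphism onto its image; the image of each piece is a
union of pieces; and break-points of pieces are mapped to break-points. -/
structure MarkovSystem (X : Type*) [TopologicalSpace X] (m : ℕ) where
  A : Fin m → Set X
  f : Fin m → X → X
  closed : ∀ i, IsClosed (A i)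
  conn : ∀ i, IsConnected (A i)
  interFin : ∀ i j, i ≠ j → (A i ∩ A j).Finite
  cover : ⋃ i, A i = Set.univ
  emb : ∀ i, Topology.IsEmbedding ((A i).restrict (f i))
  markov : ∀ i, ∃ Js : Set (Fin m), f i '' A i = ⋃ j ∈ Js, A j
  bk_mapsTo : ∀ i, f i '' (A i ∩ bkSet A) ⊆ bkSet A

/-- The level-`n` partitions `𝒜ⁿ` of a Markov map: `𝒜⁰ = 𝒜`, and `𝒜ⁿ⁺¹` consists of the
sets `f_i⁻¹(A_w) = A_i ∩ f_i⁻¹(A_w)` for `A_w ∈ 𝒜ⁿ` with `A_w ⊆ f_i(A_i)`. -/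
def level {X : Type*} [TopologicalSpace X] {m : ℕ} (S : MarkovSystem X m) : ℕ → Set (Set X)
  | 0 => Set.range S.A
  | n + 1 => {B | ∃ i : Fin m, ∃ C ∈ level S n, C ⊆ S.f i '' S.A i ∧ B = S.A i ∩ S.f i ⁻¹' C}

/-- A Markov map is topologically expanding if for every `x ∈ X` the sets
`Int (⋃ {A_w ∈ 𝒜ⁿ : x ∈ A_w})`, `n ∈ ℕ`, form a neighborhood basis at `x`. -/
def TopExpanding {X : Type*} [TopologicalSpace X] {m : ℕ} (S : MarkovSystem X m) : Prop :=
  ∀ x : X, (𝓝 x).HasBasis (fun _ : ℕ => True)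
    (fun n => interior (⋃₀ {B | B ∈ level S n ∧ x ∈ B}))

/-- In a T₁ space, an open set meeting a preconnected set `D` in a nonempty finite set
contains `D`. -/
lemma IsPreconnected.subset_of_finite_inter_isOpen {X : Type*} [TopologicalSpace X] [T1Space X]
    {D U : Set X} (hD : IsPreconnected D) (hU : IsOpen U) (hfin : (D ∩ U).Finite)
    (hne : (D ∩ U).Nonempty) : D ⊆ U := by
  by_contra hDU
  obtain ⟨y, hyD, hyU⟩ := not_subset.1 hDU
  obtain ⟨z, hzD, hzU, hz⟩ := hD U (D ∩ U)ᶜ hU hfin.isClosed.isOpen_compl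
    (fun x hx => by by_cases h : x ∈ U <;> simp [h]) hne ⟨y, hyD, fun h => hyU h.2⟩
  exact hz ⟨hzD, hzU⟩

namespace MarkovSystem

variable {X : Type*} [TopologicalSpace X] {m : ℕ} (S T : MarkovSystem X m)

lemma isEmbedding_domRestrict (i : Fin m) : IsEmbedding ((S.A i).domRestrict (S.f i)) :=
  S.emb i

lemma injOn_f (i : Fin m) : InjOn (S.f i) (S.A i) :=
  injOn_iff_injective.2 (S.isEmbedding_domRestrict i).injective

lemma continuousOn_f (i : Fin m) : ContinuousOn (S.f i) (S.A i) :=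
  continuousOn_iff_continuous_domRestrict.2 (S.isEmbedding_domRestrict i).continuous

lemma exists_mem_A (x : X) : ∃ i, x ∈ S.A i := by
  simpa using (S.cover ▸ mem_univ x : x ∈ ⋃ i, S.A i)

lemma exists_mem_A_subset_image {i : Fin m} {x : X} (hx : x ∈ S.A i) :
    ∃ j, S.f i x ∈ S.A j ∧ S.A j ⊆ S.f i '' S.A i := by
  obtain ⟨J, hJ⟩ := S.markov i
  have h : S.f i x ∈ ⋃ j ∈ J, S.A j := hJ ▸ mem_image_of_mem _ hx
  obtain ⟨j, hj, hxj⟩ := mem_iUnion₂.1 h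
  exact ⟨j, hxj, hJ ▸ subset_biUnion_of_mem (u := S.A) hj⟩

lemma finite_level (n : ℕ) : (level S n).Finite := by
  induction n with
  | zero => exact finite_range _
  | succ n ih =>
    refine (finite_iUnion fun i : Fin m =>
      ih.image fun C => S.A i ∩ S.f i ⁻¹' C).subset ?_
    rintro _ ⟨i, C, hC, -, rfl⟩
    exact mem_iUnion.2 ⟨i, C, hC, rfl⟩

lemma isClosed_of_mem_level (n : ℕ) : ∀ C ∈ level S n, IsClosed C := by
  induction n with
  | zero => rintro _ ⟨i, rfl⟩; exact S.closed i
  | succ n ih =>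
    rintro _ ⟨i, C, hC, -, rfl⟩
    exact (S.continuousOn_f i).preimage_isClosed_of_isClosed (S.closed i) (ih C hC)

lemma isConnected_of_mem_level (n : ℕ) : ∀ C ∈ level S n, IsConnected C := by
  induction n with
  | zero => rintro _ ⟨i, rfl⟩; exact S.conn i
  | succ n ih =>
    rintro _ ⟨i, C, hC, hCi, rfl⟩
    have himg : (S.A i).domRestrict (S.f i) '' ((↑) ⁻¹' (S.f i ⁻¹' C) : Set (S.A i)) = C := by
      ext y
      constructor
      · rintro ⟨x, hx, rfl⟩
        exact hx
      · intro hy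
        obtain ⟨x, hx, rfl⟩ := hCi hy
        exact ⟨⟨x, hx⟩, hy, rfl⟩
    refine ⟨?_, ?_⟩
    · obtain ⟨y, hy⟩ := (ih C hC).nonempty
      obtain ⟨x, hx, rfl⟩ := hCi hy
      exact ⟨x, hx, hy⟩
    · rw [← Subtype.image_preimage_coe]
      refine IsPreconnected.image ?_ _ continuous_subtype_val.continuousOn
      rw [← (S.isEmbedding_domRestrict i).isInducing.isPreconnected_image, himg]
      exact (ih C hC).isPreconnected

lemma finite_inter_of_mem_level (n : ℕ) :
    ∀ C ∈ level S n, ∀ D ∈ level S n, C ≠ D → (C ∩ D).Finite := by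
  induction n with
  | zero =>
    rintro _ ⟨i, rfl⟩ _ ⟨j, rfl⟩ h
    exact S.interFin i j fun hij => h (by rw [hij])
  | succ n ih =>
    rintro _ ⟨i, C, hC, -, rfl⟩ _ ⟨j, D, hD, -, rfl⟩ h
    by_cases hij : i = j
    · subst hij
      refine Finite.of_finite_image ((ih C hC D hD fun hCD => h (by rw [hCD])).subset ?_)
        ((S.injOn_f i).mono fun x hx => hx.1.1)
      rintro _ ⟨x, hx, rfl⟩
      exact ⟨hx.1.2, hx.2.2⟩
    · exact (S.interFin i j hij).subset fun x hx => ⟨hx.1.1, hx.2.1⟩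

variable {S T}

lemma mapsTo_A_image_f {h : X → X} (hmaps : ∀ i, MapsTo h (S.A i) (T.A i))
    (hmat : ∀ i j, S.A i ⊆ S.f j '' S.A j → T.A i ⊆ T.f j '' T.A j) {i : Fin m} {x : X}
    (hx : x ∈ S.A i) : h (S.f i x) ∈ T.f i '' T.A i := by
  obtain ⟨j, hj, hji⟩ := S.exists_mem_A_subset_image hx
  exact hmat j i hji (hmaps j hj)

/-- Maps which agree with the dynamics along `k` steps send each point into a common
level-`k` piece. -/
lemma exists_common_level (Q : ℕ → Set (X → X))
    (hmat : ∀ i j, S.A i ⊆ S.f j '' S.A j → T.A i ⊆ T.f j '' T.A j)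
    (hmaps : ∀ k, ∀ h ∈ Q k, ∀ i, MapsTo h (S.A i) (T.A i))
    (hstep : ∀ k, ∀ h ∈ Q (k + 1), ∃ h' ∈ Q k,
      ∀ i, ∀ x ∈ S.A i, h' (S.f i x) = T.f i (h x)) (k : ℕ) :
    ∀ (l : Fin m), ∀ x ∈ S.A l, ∃ D ∈ level T k, D ⊆ T.A l ∧ ∀ h ∈ Q k, h x ∈ D := by
  induction k with
  | zero => exact fun l x hx => ⟨T.A l, mem_range_self l, Subset.rfl, fun h hh => hmaps 0 h hh l hx⟩
  | succ k ih =>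
    intro l x hx
    obtain ⟨j, hj, hjl⟩ := S.exists_mem_A_subset_image hx
    obtain ⟨D, hD, hDj, hQ⟩ := ih j _ hj
    refine ⟨T.A l ∩ T.f l ⁻¹' D, ⟨l, D, hD, hDj.trans (hmat j l hjl), rfl⟩, inter_subset_left,
      fun h hh => ⟨hmaps _ h hh l hx, ?_⟩⟩
    obtain ⟨h', hh', heq⟩ := hstep k h hh
    rw [mem_preimage, ← heq l x hx]
    exact hQ h' hh'

variable (S) in
lemma exists_mem_level (n : ℕ) (x : X) : ∃ D ∈ level S n, x ∈ D := by
  obtain ⟨l, hl⟩ := S.exists_mem_A x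
  obtain ⟨D, hD, -, hQ⟩ := exists_common_level (S := S) (T := S) (fun _ => {id}) (fun _ _ => id)
    (by rintro - _ rfl i; exact mapsTo_id _)
    (by rintro - _ rfl; exact ⟨id, rfl, fun _ _ _ => rfl⟩) n l x hl
  exact ⟨D, hD, hQ id rfl⟩

/-- For an expanding system, points lying in common pieces of all levels up to a large `N`
are close to each other. -/
lemma exists_dist_le_of_common_level {X : Type*} [MetricSpace X] [CompactSpace X] {m : ℕ}
    (S : MarkovSystem X m) (hS : TopExpanding S) {ε : ℝ} (hε : 0 < ε) :
    ∃ N : ℕ, ∀ y z : X, (∀ n ≤ N, ∃ D ∈ level S n, y ∈ D ∧ z ∈ D) → dist y z ≤ ε := by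
  let star : ℕ → X → Set X := fun n x => ⋃₀ {B | B ∈ level S n ∧ x ∈ B}
  have hfin : ∀ n x, ∀ D ∈ level S n, x ∉ D → (D ∩ star n x).Finite := by
    intro n x D hD hxD
    rw [show star n x = _ from sUnion_eq_biUnion, inter_iUnion₂]
    refine ((S.finite_level n).subset fun B hB => hB.1).biUnion fun B hB => ?_
    exact S.finite_inter_of_mem_level n D hD B hB.1 fun h => hxD (h ▸ hB.2)
  have hsub : ∀ x, ∃ n, star n x ⊆ Metric.closedBall x (ε / 2) := by
    intro x
    obtain ⟨n, -, hn⟩ := (hS x).mem_iff.1 (Metric.closedBall_mem_nhds x (half_pos hε))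
    refine ⟨n, sUnion_subset fun D hD => ?_⟩
    have hDfin : (D \ interior (star n x)).Finite := by
      let R : Set X := ⋃ B ∈ {B | B ∈ level S n ∧ x ∉ B}, B
      have hR : IsClosed R := ((S.finite_level n).subset fun B hB => hB.1).isClosed_biUnion
        fun B hB => S.isClosed_of_mem_level n B hB.1
      have hint : Rᶜ ⊆ interior (star n x) := by
        refine interior_maximal (fun y hy => ?_) hR.isOpen_compl
        obtain ⟨B, hB, hyB⟩ := S.exists_mem_level n y
        exact ⟨B, ⟨hB, by_contra fun hxB => hy (mem_biUnion ⟨hB, hxB⟩ hyB)⟩, hyB⟩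
      have hDR : (D ∩ R).Finite := by
        rw [inter_iUnion₂]
        refine ((S.finite_level n).subset fun B hB => hB.1).biUnion fun B hB => ?_
        exact S.finite_inter_of_mem_level n D hD.1 B hB.1 fun h => hB.2 (h ▸ hD.2)
      exact hDR.subset fun y hy => ⟨hy.1, by_contra fun h => hy.2 (hint h)⟩
    by_contra hcon
    obtain ⟨y, hyD, hy⟩ := not_subset.1 hcon
    exact (S.isConnected_of_mem_level n D hD.1).isPreconnected.subset_of_finite_inter_isOpen
      Metric.isClosed_closedBall.isOpen_compl
      (hDfin.subset fun z hz => ⟨hz.1, fun h => hz.2 (hn h)⟩) ⟨y, hyD, hy⟩ hD.2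
      (Metric.mem_closedBall_self (half_pos hε).le)
  choose k hk using hsub
  obtain ⟨t, ht⟩ := CompactSpace.elim_nhds_subcover (fun x => interior (star (k x) x))
    fun x => (hS x).mem_of_mem trivial
  refine ⟨t.sup k, fun y z hyz => ?_⟩
  obtain ⟨x, hxt, hyx⟩ := mem_iUnion₂.1 (ht.ge (mem_univ y))
  obtain ⟨D, hD, hyD, hzD⟩ := hyz (k x) (Finset.le_sup hxt)
  have hDx : D ⊆ star (k x) x := by
    by_cases hxD : x ∈ D
    · exact subset_sUnion_of_mem ⟨hD, hxD⟩
    · exact ((S.isConnected_of_mem_level _ D hD).isPreconnected.subset_of_finite_inter_isOpen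
        isOpen_interior ((hfin _ x D hD hxD).subset
          (inter_subset_inter_right _ interior_subset)) ⟨y, hyD, hyx⟩).trans interior_subset
  have hy := Metric.mem_closedBall.1 (hk x (hDx hyD))
  have hz := Metric.mem_closedBall.1 (hk x (hDx hzD))
  linarith [dist_triangle_right y z x]

/-- One step of lifting an approximate conjugacy through the dynamics. -/
lemma exists_lift {H₀ h : X → X}
    (hH₀ : ∀ i, MapsTo H₀ (S.A i) (T.A i))
    (hbk : ∀ i, ∀ x ∈ S.A i ∩ bkSet S.A, H₀ (S.f i x) = T.f i (H₀ x))
    (hmat : ∀ i j, S.A i ⊆ S.f j '' S.A j → T.A i ⊆ T.f j '' T.A j)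
    (hc : Continuous h) (hmaps : ∀ i, MapsTo h (S.A i) (T.A i))
    (heq : EqOn h H₀ (bkSet S.A)) :
    ∃ h' : X → X, Continuous h' ∧ (∀ i, MapsTo h' (S.A i) (T.A i)) ∧
      EqOn h' H₀ (bkSet S.A) ∧ ∀ i, ∀ x ∈ S.A i, h (S.f i x) = T.f i (h' x) := by
  have hbk' : ∀ i, ∀ x ∈ S.A i ∩ bkSet S.A, h (S.f i x) = T.f i (H₀ x) := fun i x hx => by
    rw [heq (S.bk_mapsTo i (mem_image_of_mem _ hx)), hbk i x hx]
  have hex : ∀ x, ∃ y, ∀ i, x ∈ S.A i → y ∈ T.A i ∧ h (S.f i x) = T.f i y := by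
    intro x
    by_cases hx : x ∈ bkSet S.A
    · exact ⟨H₀ x, fun i hi => ⟨hH₀ i hi, hbk' i x ⟨hi, hx⟩⟩⟩
    · obtain ⟨i, hi⟩ := S.exists_mem_A x
      obtain ⟨y, hy, hyx⟩ := mapsTo_A_image_f hmaps hmat hi
      refine ⟨y, fun j hj => ?_⟩
      obtain rfl : i = j := by_contra fun hij => hx ⟨i, j, hij, hi, hj⟩
      exact ⟨hy, hyx.symm⟩
  choose h' hh' using hex
  have hmaps' : ∀ i, MapsTo h' (S.A i) (T.A i) := fun i x hx => (hh' x i hx).1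
  refine ⟨h', ?_, hmaps', ?_, fun i x hx => (hh' x i hx).2⟩
  · refine (locallyFinite_of_finite S.A).continuous S.cover S.closed fun i => ?_
    have hind : Continuous ((hmaps' i).restrict h' (S.A i) (T.A i)) := by
      rw [(T.isEmbedding_domRestrict i).continuous_iff]
      have : (T.A i).domRestrict (T.f i) ∘ (hmaps' i).restrict h' (S.A i) (T.A i) =
          (S.A i).domRestrict (h ∘ S.f i) := by
        ext x
        exact (hh' x i x.2).2.symm
      rw [this]
      exact continuousOn_iff_continuous_domRestrict.1 (hc.comp_continuousOn (S.continuousOn_f i))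
    exact continuousOn_iff_continuous_domRestrict.2 (continuous_subtype_val.comp hind)
  · intro x hx
    obtain ⟨i, hi⟩ := S.exists_mem_A x
    exact T.injOn_f i (hmaps' i hi) (hH₀ i hi)
      ((hh' x i hi).2.symm.trans (hbk' i x ⟨hi, hx⟩))

lemma exists_continuous_semiconj {X : Type*} [MetricSpace X] [CompactSpace X] {m : ℕ}
    {S T : MarkovSystem X m} (hT : TopExpanding T) {H₀ : X → X} (hc : Continuous H₀)
    (hH₀ : ∀ i, MapsTo H₀ (S.A i) (T.A i))
    (hbk : ∀ i, ∀ x ∈ S.A i ∩ bkSet S.A, H₀ (S.f i x) = T.f i (H₀ x))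
    (hmat : ∀ i j, S.A i ⊆ S.f j '' S.A j → T.A i ⊆ T.f j '' T.A j) :
    ∃ H : X → X, Continuous H ∧ (∀ i, MapsTo H (S.A i) (T.A i)) ∧
      ∀ i, ∀ x ∈ S.A i, H (S.f i x) = T.f i (H x) := by
  let P := {h : X → X // Continuous h ∧ (∀ i, MapsTo h (S.A i) (T.A i)) ∧
    EqOn h H₀ (bkSet S.A)}
  have hlift : ∀ h : P, ∃ h' : P, ∀ i, ∀ x ∈ S.A i, h.1 (S.f i x) = T.f i (h'.1 x) := by
    rintro ⟨h, h1, h2, h3⟩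
    obtain ⟨h', h1', h2', h3', h4'⟩ := exists_lift hH₀ hbk hmat h1 h2 h3
    exact ⟨⟨h', h1', h2', h3'⟩, h4'⟩
  choose L hL using hlift
  let h : ℕ → P := fun n => L^[n] ⟨H₀, hc, hH₀, eqOn_refl _ _⟩
  have hsucc : ∀ n, ∀ i, ∀ x ∈ S.A i, (h n).1 (S.f i x) = T.f i ((h (n + 1)).1 x) := by
    intro n
    simp only [h, Function.iterate_succ_apply']
    exact hL _
  have hcommon := exists_common_level (S := S) (T := T)
    (fun k => {g | ∃ j ≥ k, g = (h j).1}) hmat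
    (by rintro k _ ⟨j, -, rfl⟩; exact (h j).2.2.1)
    (by
      rintro k _ ⟨j, hj, rfl⟩
      obtain ⟨j, rfl⟩ := Nat.exists_eq_succ_of_ne_zero (by omega : j ≠ 0)
      exact ⟨_, ⟨j, by omega, rfl⟩, hsucc j⟩)
  have hclose : ∀ ε > 0, ∃ N, ∀ i ≥ N, ∀ j ≥ N, ∀ x, dist ((h i).1 x) ((h j).1 x) ≤ ε := by
    intro ε hε
    obtain ⟨N, hN⟩ := T.exists_dist_le_of_common_level hT hε
    refine ⟨N, fun i hi j hj x => hN _ _ fun n hn => ?_⟩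
    obtain ⟨l, hl⟩ := S.exists_mem_A x
    obtain ⟨D, hD, -, hQ⟩ := hcommon n l x hl
    exact ⟨D, hD, hQ _ ⟨i, by omega, rfl⟩, hQ _ ⟨j, by omega, rfl⟩⟩
  have hcauchy : ∀ x, ∃ y, Tendsto (fun n => (h n).1 x) atTop (𝓝 y) := by
    intro x
    refine cauchySeq_tendsto_of_complete (Metric.cauchySeq_iff.2 fun ε hε => ?_)
    obtain ⟨N, hN⟩ := hclose (ε / 2) (half_pos hε)
    exact ⟨N, fun i hi j hj => (hN i hi j hj x).trans_lt (half_lt_self hε)⟩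
  choose H hH using hcauchy
  have hmaps : ∀ i, MapsTo H (S.A i) (T.A i) := fun i x hx =>
    (T.closed i).mem_of_tendsto (hH x) (Eventually.of_forall fun n => (h n).2.2.1 i hx)
  refine ⟨H, ?_, hmaps, fun i x hx => ?_⟩
  · have hunif : TendstoUniformly (fun n => (h n).1) H atTop := by
      refine Metric.tendstoUniformly_iff.2 fun ε hε => ?_
      obtain ⟨N, hN⟩ := hclose (ε / 2) (half_pos hε)
      filter_upwards [eventually_ge_atTop N] with n hn x
      refine lt_of_le_of_lt ?_ (half_lt_self hε)
      refine le_of_tendsto ((hH x).dist tendsto_const_nhds) ?_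
      filter_upwards [eventually_ge_atTop N] with j hj using hN j hj n hn x
    exact hunif.continuous (Frequently.of_forall fun n => (h n).2.1)
  · refine tendsto_nhds_unique (hH _) ?_
    simp only [hsucc _ i x hx]
    refine (T.continuousOn_f i _ (hmaps i hx)).tendsto.comp
      (tendsto_nhdsWithin_iff.2 ⟨(hH x).comp (tendsto_add_atTop_nat 1), ?_⟩)
    exact Eventually.of_forall fun n => (h (n + 1)).2.2.1 i hx

lemma eq_id_of_semiconj {X : Type*} [MetricSpace X] [CompactSpace X] {m : ℕ}
    {S : MarkovSystem X m} (hS : TopExpanding S) {h : X → X}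
    (hmaps : ∀ i, MapsTo h (S.A i) (S.A i))
    (hconj : ∀ i, ∀ x ∈ S.A i, h (S.f i x) = S.f i (h x)) (x : X) : h x = x := by
  refine dist_le_zero.1 (le_of_forall_pos_le_add fun ε hε => ?_)
  obtain ⟨N, hN⟩ := S.exists_dist_le_of_common_level hS hε
  rw [zero_add]
  refine hN _ _ fun n _ => ?_
  obtain ⟨l, hl⟩ := S.exists_mem_A x
  obtain ⟨D, hD, -, hQ⟩ := exists_common_level (S := S) (T := S) (fun _ => {h, id})
    (fun _ _ => id) (by rintro - _ (rfl | rfl) i; exacts [hmaps i, mapsTo_id _])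
    (by
      rintro - g hg
      refine ⟨g, hg, ?_⟩
      obtain (rfl | rfl) := hg
      exacts [hconj, fun _ _ _ => rfl]) n l x hl
  exact ⟨D, hD, hQ h (Or.inl rfl), hQ id (Or.inr rfl)⟩

end MarkovSystem

/-- If two topologically expanding Markov maps `ℱ`, `𝒢` on a compact metrizable space `X`
are combinatorially conjugate (via a homeomorphism `H₀` with `H₀(A_i) = B_i`, intertwining the
dynamics at break-points, and with equal Markov matrices), then they are topologically
conjugate: there is a homeomorphism `H : X → X` with `H (f_i x) = g_i (H x)` for every `i`
and every `x ∈ A_i`. -/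
theorem markov_comb_conj_implies_top_conj
    {X : Type*} [TopologicalSpace X] [CompactSpace X] [TopologicalSpace.MetrizableSpace X]
    {m : ℕ} (S T : MarkovSystem X m)
    (hS : TopExpanding S) (hT : TopExpanding T)
    (H₀ : X ≃ₜ X)
    (hpart : ∀ i, ⇑H₀ '' S.A i = T.A i)
    (hbk : ∀ i, ∀ x ∈ S.A i ∩ bkSet S.A, H₀ (S.f i x) = T.f i (H₀ x))
    (hmat : ∀ i j, S.A i ⊆ S.f j '' S.A j ↔ T.A i ⊆ T.f j '' T.A j) :
    ∃ H : X ≃ₜ X, ∀ i, ∀ x ∈ S.A i, H (S.f i x) = T.f i (H x) := by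
  let _ : MetricSpace X := TopologicalSpace.metrizableSpaceMetric X
  have hmaps : ∀ i, MapsTo H₀ (S.A i) (T.A i) := fun i x hx => hpart i ▸ mem_image_of_mem _ hx
  have hmaps' : ∀ i, MapsTo H₀.symm (T.A i) (S.A i) := by
    intro i y hy
    rw [← hpart i] at hy
    obtain ⟨x, hx, rfl⟩ := hy
    simpa using hx
  have hbk' : ∀ i, ∀ y ∈ T.A i ∩ bkSet T.A, H₀.symm (T.f i y) = S.f i (H₀.symm y) := by
    rintro i y ⟨hy, k, l, hkl, hk, hl⟩
    rw [H₀.symm_apply_eq, hbk i _ ⟨hmaps' i hy, k, l, hkl, hmaps' k hk, hmaps' l hl⟩,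
      H₀.apply_symm_apply]
  obtain ⟨H, hHc, hHm, hH⟩ := MarkovSystem.exists_continuous_semiconj hT H₀.continuous hmaps hbk
    fun i j => (hmat i j).1
  obtain ⟨K, hKc, hKm, hK⟩ := MarkovSystem.exists_continuous_semiconj hS H₀.symm.continuous
    hmaps' hbk' fun i j => (hmat i j).2
  have hKH : ∀ x, K (H x) = x := MarkovSystem.eq_id_of_semiconj hS (h := K ∘ H)
    (fun i => (hKm i).comp (hHm i)) fun i x hx => by
      simp only [Function.comp_apply, hH i x hx, hK i _ (hHm i hx)]
  have hHK : ∀ x, H (K x) = x := MarkovSystem.eq_id_of_semiconj hT (h := H ∘ K)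
    (fun i => (hHm i).comp (hKm i)) fun i x hx => by
      simp only [Function.comp_apply, hK i x hx, hH i _ (hKm i hx)]
  exact ⟨⟨⟨H, K, hKH, hHK⟩, hHc, hKc⟩, hH⟩
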